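/- Every nontrivial periodic wave in 𝒲₀ (that is, a nontrivial wave in 𝒲 with u_x ≤ 0 on S⁺) satisfies the strict inequality u_x < 0 at every point of Ω⁺ ∪ S⁺. -/

import Mathlib

open Set

/-- Partial derivative in the horizontal direction. -/
noncomputable def pdX (f : ℝ × ℝ → ℝ) (p : ℝ × ℝ) : ℝ := fderiv ℝ f p (1, 0)

/-- Partial derivative in the vertical direction. -/
noncomputable def pdY (f : ℝ × ℝ → ℝ) (p : ℝ × ℝ) : ℝ := fderiv ℝ f p (0, 1)

/-- A symmetric `2L`-periodic steady gravity water wave with vorticity, in the frame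
moving with the wave.  The fluid occupies `Ω = {(x,y) : -L < x < L, -d < y < η x}`;
`u, v` are the relative velocity components, `P` is the pressure, `η` the surface
profile, `ψ` the stream function and `γ` the vorticity function. -/
structure PeriodicWave (g Patm L : ℝ) : Type where
  u : ℝ × ℝ → ℝ
  v : ℝ × ℝ → ℝ
  P : ℝ × ℝ → ℝ
  η : ℝ → ℝ
  ψ : ℝ × ℝ → ℝ
  γ : ℝ → ℝ
  d : ℝ
  m : ℝ
  d_pos : 0 < d
  m_pos : 0 < m
  u_smooth : ContDiff ℝ 3 u
  v_smooth : ContDiff ℝ 3 v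
  P_smooth : ContDiff ℝ 3 P
  η_smooth : ContDiff ℝ 4 η
  ψ_smooth : ContDiff ℝ 4 ψ
  γ_smooth : ContDiffOn ℝ 2 γ (Icc 0 m)
  u_periodic : ∀ x y, u (x + 2 * L, y) = u (x, y)
  v_periodic : ∀ x y, v (x + 2 * L, y) = v (x, y)
  P_periodic : ∀ x y, P (x + 2 * L, y) = P (x, y)
  η_periodic : ∀ x, η (x + 2 * L) = η x
  η_mean : (∫ x in (-L)..L, η x) = 0
  u_even : ∀ x y, u (-x, y) = u (x, y)
  v_odd : ∀ x y, v (-x, y) = -v (x, y)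
  P_even : ∀ x y, P (-x, y) = P (x, y)
  η_even : ∀ x, η (-x) = η x
  euler_x : ∀ x y, -d < y → y < η x →
    u (x, y) * pdX u (x, y) + v (x, y) * pdY u (x, y) = -pdX P (x, y)
  euler_y : ∀ x y, -d < y → y < η x →
    u (x, y) * pdX v (x, y) + v (x, y) * pdY v (x, y) = -(pdY P (x, y)) - g
  incompressible : ∀ x y, -d < y → y < η x → pdX u (x, y) + pdY v (x, y) = 0
  surface_pressure : ∀ x, P (x, η x) = Patm
  surface_kinematic : ∀ x, v (x, η x) = deriv η x * u (x, η x)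
  bed_kinematic : ∀ x, v (x, -d) = 0
  nonstagnant : ∃ δ > 0, ∀ x y, -d ≤ y → y ≤ η x → u (x, y) ≤ -δ
  psi_x : ∀ x y, -d ≤ y → y ≤ η x → pdX ψ (x, y) = -v (x, y)
  psi_y : ∀ x y, -d ≤ y → y ≤ η x → pdY ψ (x, y) = u (x, y)
  psi_surface : ∀ x, ψ (x, η x) = 0
  psi_bed : ∀ x, ψ (x, -d) = m
  vorticity_eq : ∀ x y, -d < y → y < η x → pdX v (x, y) - pdY u (x, y) = γ (ψ (x, y))

namespace PeriodicWave

variable {g Patm L : ℝ}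

/-- The closure of one period `Ω` of the fluid domain. -/
def Ωbar (W : PeriodicWave g Patm L) : Set (ℝ × ℝ) :=
  {p | -L ≤ p.1 ∧ p.1 ≤ L ∧ -W.d ≤ p.2 ∧ p.2 ≤ W.η p.1}

/-- The open half period `Ω⁺` of the fluid domain. -/
def Ωplus (W : PeriodicWave g Patm L) : Set (ℝ × ℝ) :=
  {p | 0 < p.1 ∧ p.1 < L ∧ -W.d < p.2 ∧ p.2 < W.η p.1}

/-- The half period `S⁺` of the free surface. -/
def Splus (W : PeriodicWave g Patm L) : Set (ℝ × ℝ) :=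
  {p | 0 < p.1 ∧ p.1 < L ∧ p.2 = W.η p.1}

/-- A wave is trivial if `u, v, P, η` depend only on `y`. -/
def IsTrivial (W : PeriodicWave g Patm L) : Prop :=
  (∀ p, W.v p = 0) ∧ (∀ x, W.η x = 0) ∧
    (∀ x x' y, W.u (x, y) = W.u (x', y)) ∧ (∀ x x' y, W.P (x, y) = W.P (x', y))

/-- The streamline monotonicity condition `v > 0` on `Ω⁺ ∪ S⁺`. -/
def MonotoneHalf (W : PeriodicWave g Patm L) : Prop :=
  ∀ p ∈ W.Ωplus ∪ W.Splus, 0 < W.v p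

/-- Membership in the water-wave set 𝒲 : the vorticity function satisfies
`γ ≤ 0`, `γ' ≤ 0`, `γ'' ≤ 0` on `[0, m]`, and the wave is either trivial or
monotone. -/
def MemW (W : PeriodicWave g Patm L) : Prop :=
  (∀ s ∈ Icc (0:ℝ) W.m, W.γ s ≤ 0) ∧
  (∀ s ∈ Icc (0:ℝ) W.m, derivWithin W.γ (Icc 0 W.m) s ≤ 0) ∧
  (∀ s ∈ Icc (0:ℝ) W.m, derivWithin (derivWithin W.γ (Icc 0 W.m)) (Icc 0 W.m) s ≤ 0) ∧
  (W.IsTrivial ∨ W.MonotoneHalf)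

/-- The trace of `(u, v, u_x, v_x, u_y, u_xx, u_xy)` on the free surface. -/
noncomputable def trace (W : PeriodicWave g Patm L) (x : ℝ) :
    ℝ × ℝ × ℝ × ℝ × ℝ × ℝ × ℝ :=
  (W.u (x, W.η x), W.v (x, W.η x), pdX W.u (x, W.η x), pdX W.v (x, W.η x),
    pdY W.u (x, W.η x), pdX (pdX W.u) (x, W.η x), pdY (pdX W.u) (x, W.η x))

end PeriodicWave

section PartialDerivatives

open Filter Topology

variable {f : ℝ × ℝ → ℝ}

theorem contDiff_pdX {n : WithTop ℕ∞} (hf : ContDiff ℝ (n + 1) f) : ContDiff ℝ n (pdX f) :=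
  (hf.fderiv_right le_rfl).clm_apply contDiff_const

theorem contDiff_pdY {n : WithTop ℕ∞} (hf : ContDiff ℝ (n + 1) f) : ContDiff ℝ n (pdY f) :=
  (hf.fderiv_right le_rfl).clm_apply contDiff_const

theorem hasDerivAt_along_curve (hf : ContDiff ℝ 1 f) {a b : ℝ → ℝ} {a' b' t : ℝ}
    (ha : HasDerivAt a a' t) (hb : HasDerivAt b b' t) :
    HasDerivAt (fun s => f (a s, b s)) (a' * pdX f (a t, b t) + b' * pdY f (a t, b t)) t := by
  have hd : HasFDerivAt f (fderiv ℝ f (a t, b t)) (a t, b t) :=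
    (hf.differentiable one_ne_zero _).hasFDerivAt
  have h := hd.comp_hasDerivAt t (ha.prodMk hb)
  have e : ((a', b') : ℝ × ℝ) = a' • ((1, 0) : ℝ × ℝ) + b' • ((0, 1) : ℝ × ℝ) := by
    ext <;> simp
  rw [e, map_add, map_smul, map_smul] at h
  exact h

theorem hasDerivAt_slice_fst (hf : ContDiff ℝ 1 f) (x y : ℝ) :
    HasDerivAt (fun t => f (t, y)) (pdX f (x, y)) x := by
  simpa using hasDerivAt_along_curve hf (hasDerivAt_id x) (hasDerivAt_const x y)

theorem hasDerivAt_slice_snd (hf : ContDiff ℝ 1 f) (x y : ℝ) :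
    HasDerivAt (fun t => f (x, t)) (pdY f (x, y)) y := by
  simpa using hasDerivAt_along_curve hf (hasDerivAt_const y x) (hasDerivAt_id y)

theorem pdX_pdY_comm (hf : ContDiff ℝ 2 f) : pdX (pdY f) = pdY (pdX f) := by
  funext p
  have hd : DifferentiableAt ℝ (fderiv ℝ f) p :=
    (hf.fderiv_right (m := 1) (by norm_num)).differentiable one_ne_zero p
  have hs : IsSymmSndFDerivAt ℝ f p := hf.contDiffAt.isSymmSndFDerivAt (by simp)
  have key (a b : ℝ × ℝ) :
      fderiv ℝ (fun q => fderiv ℝ f q a) p b = fderiv ℝ (fderiv ℝ f) p b a := by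
    rw [fderiv_clm_apply hd (differentiableAt_const a)]
    simp
  change fderiv ℝ (fun q => fderiv ℝ f q (0, 1)) p (1, 0) =
    fderiv ℝ (fun q => fderiv ℝ f q (1, 0)) p (0, 1)
  rw [key, key]
  exact hs.eq _ _

end PartialDerivatives

section MaximumPrinciple

open Filter Topology

theorem IsLocalMax.second_deriv_nonpos {f f' : ℝ → ℝ} {f'' a : ℝ} (h : IsLocalMax f a)
    (hf : ∀ t, HasDerivAt f (f' t) t) (hf' : HasDerivAt f' f'' a) : f'' ≤ 0 := by
  by_contra! hpos
  have e : deriv f = f' := funext fun t => (hf t).deriv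
  have hmin : IsLocalMin f a := by
    refine isLocalMin_of_deriv_deriv_pos ?_ ?_ (hf a).continuousAt
    · rw [e, hf'.deriv]; exact hpos
    · exact h.deriv_eq_zero
  have hc : f =ᶠ[𝓝 a] fun _ => f a := by
    filter_upwards [h, hmin] with t h₁ h₂ using le_antisymm h₁ h₂
  have hc' : f' =ᶠ[𝓝 a] fun _ => 0 := by
    rw [← e]; simpa using hc.deriv
  have := hc'.deriv_eq
  rw [hf'.deriv, deriv_const] at this
  exact hpos.ne' this

theorem laplacian_nonpos_of_isLocalMax {f : ℝ × ℝ → ℝ} (hf : ContDiff ℝ 2 f) {p : ℝ × ℝ}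
    (h : IsLocalMax f p) : pdX (pdX f) p + pdY (pdY f) p ≤ 0 := by
  obtain ⟨x, y⟩ := p
  have h1 : ContDiff ℝ 1 f := hf.of_le (by norm_num)
  have hx : pdX (pdX f) (x, y) ≤ 0 := by
    refine IsLocalMax.second_deriv_nonpos (f := fun t => f (t, y)) ?_
      (fun t => hasDerivAt_slice_fst h1 t y) (hasDerivAt_slice_fst (contDiff_pdX hf) x y)
    have hc : Tendsto (fun t : ℝ => (t, y)) (𝓝 x) (𝓝 (x, y)) :=
      (show Continuous fun t : ℝ => (t, y) by fun_prop).tendsto x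
    exact hc.eventually h
  have hy : pdY (pdY f) (x, y) ≤ 0 := by
    refine IsLocalMax.second_deriv_nonpos (f := fun t => f (x, t)) ?_
      (fun t => hasDerivAt_slice_snd h1 x t) (hasDerivAt_slice_snd (contDiff_pdY hf) x y)
    have hc : Tendsto (fun t : ℝ => (x, t)) (𝓝 y) (𝓝 (x, y)) :=
      (show Continuous fun t : ℝ => (x, t) by fun_prop).tendsto y
    exact hc.eventually h
  linarith

theorem pdX_eq_of_hasDerivAt {f : ℝ × ℝ → ℝ} {x y c : ℝ} (hf : ContDiff ℝ 1 f)
    (h : HasDerivAt (fun t => f (t, y)) c x) : pdX f (x, y) = c :=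
  (hasDerivAt_slice_fst hf x y).unique h

theorem pdY_eq_of_hasDerivAt {f : ℝ × ℝ → ℝ} {x y c : ℝ} (hf : ContDiff ℝ 1 f)
    (h : HasDerivAt (fun t => f (x, t)) c y) : pdY f (x, y) = c :=
  (hasDerivAt_slice_snd hf x y).unique h

theorem laplacian_add_smul {f h : ℝ × ℝ → ℝ} (hf : ContDiff ℝ 2 f) (hh : ContDiff ℝ 2 h)
    (ε : ℝ) (p : ℝ × ℝ) :
    pdX (pdX fun q => f q + ε * h q) p + pdY (pdY fun q => f q + ε * h q) p =
      (pdX (pdX f) p + pdY (pdY f) p) + ε * (pdX (pdX h) p + pdY (pdY h) p) := by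
  have hs : ContDiff ℝ 2 fun q => f q + ε * h q := hf.add (contDiff_const.mul hh)
  have f1 : ContDiff ℝ 1 f := hf.of_le (by norm_num)
  have h1 : ContDiff ℝ 1 h := hh.of_le (by norm_num)
  have s1 : ContDiff ℝ 1 fun q => f q + ε * h q := hs.of_le (by norm_num)
  have eX : (pdX fun q => f q + ε * h q) = fun q => pdX f q + ε * pdX h q := by
    funext ⟨x, y⟩
    exact pdX_eq_of_hasDerivAt s1
      ((hasDerivAt_slice_fst f1 x y).add ((hasDerivAt_slice_fst h1 x y).const_mul ε))
  have eY : (pdY fun q => f q + ε * h q) = fun q => pdY f q + ε * pdY h q := by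
    funext ⟨x, y⟩
    exact pdY_eq_of_hasDerivAt s1
      ((hasDerivAt_slice_snd f1 x y).add ((hasDerivAt_slice_snd h1 x y).const_mul ε))
  obtain ⟨x, y⟩ := p
  have fX : ContDiff ℝ 1 (pdX f) := contDiff_pdX hf
  have fY : ContDiff ℝ 1 (pdY f) := contDiff_pdY hf
  have hX : ContDiff ℝ 1 (pdX h) := contDiff_pdX hh
  have hY : ContDiff ℝ 1 (pdY h) := contDiff_pdY hh
  have eXX : pdX (fun q => pdX f q + ε * pdX h q) (x, y) = _ :=
    pdX_eq_of_hasDerivAt (fX.add (contDiff_const.mul hX))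
      ((hasDerivAt_slice_fst fX x y).add ((hasDerivAt_slice_fst hX x y).const_mul ε))
  have eYY : pdY (fun q => pdY f q + ε * pdY h q) (x, y) = _ :=
    pdY_eq_of_hasDerivAt (fY.add (contDiff_const.mul hY))
      ((hasDerivAt_slice_snd fY x y).add ((hasDerivAt_slice_snd hY x y).const_mul ε))
  rw [eX, eY, eXX, eYY]
  ring

/-- A weak maximum principle: a function which is subharmonic wherever it is positive, and which
is positive only in the interior of the compact set `K`, is nonpositive on `K`. -/
theorem nonpos_of_laplacian_nonneg {f : ℝ × ℝ → ℝ} (hf : ContDiff ℝ 2 f) {K : Set (ℝ × ℝ)}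
    (hK : IsCompact K)
    (h : ∀ p ∈ K, 0 < f p → K ∈ 𝓝 p ∧ 0 ≤ pdX (pdX f) p + pdY (pdY f) p) :
    ∀ p ∈ K, f p ≤ 0 := by
  intro q hq
  by_contra! hpos
  have hsq : ContDiff ℝ 2 fun p : ℝ × ℝ => p.1 ^ 2 := by fun_prop
  obtain ⟨B, hB⟩ := (hK.image hsq.continuous).bddAbove
  have hB' : ∀ p ∈ K, p.1 ^ 2 ≤ B := fun p hp => hB ⟨p, hp, rfl⟩
  have hB0 : 0 ≤ B := (sq_nonneg _).trans (hB' q hq)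
  set ε := f q / (B + 1) / 2 with hε
  have hε0 : 0 < ε := by positivity
  have hεB : ε * B < f q := by
    rw [hε, div_div, div_mul_eq_mul_div, div_lt_iff₀ (by positivity)]
    nlinarith
  have hF : ContDiff ℝ 2 fun p : ℝ × ℝ => f p + ε * p.1 ^ 2 := hf.add (contDiff_const.mul hsq)
  obtain ⟨p, hp, hmax⟩ := hK.exists_isMaxOn ⟨q, hq⟩ hF.continuous.continuousOn
  have hfp : 0 < f p := by
    have h₁ : f q + ε * q.1 ^ 2 ≤ f p + ε * p.1 ^ 2 := hmax hq
    have h₂ := mul_le_mul_of_nonneg_left (hB' p hp) hε0.le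
    nlinarith [mul_nonneg hε0.le (sq_nonneg q.1)]
  obtain ⟨hnhds, hlap⟩ := h p hp hfp
  have hle := laplacian_nonpos_of_isLocalMax hF (hmax.isLocalMax hnhds)
  rw [laplacian_add_smul hf hsq] at hle
  have s1 : ContDiff ℝ 1 fun p : ℝ × ℝ => p.1 ^ 2 := by fun_prop
  have eX : (pdX fun p : ℝ × ℝ => p.1 ^ 2) = fun p => 2 * p.1 := by
    funext ⟨x, y⟩
    exact pdX_eq_of_hasDerivAt s1 (by simpa using hasDerivAt_pow 2 x)
  have eY : (pdY fun p : ℝ × ℝ => p.1 ^ 2) = fun _ => 0 := by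
    funext ⟨x, y⟩
    exact pdY_eq_of_hasDerivAt s1 (hasDerivAt_const y (x ^ 2))
  have eXX : pdX (fun p : ℝ × ℝ => 2 * p.1) p = 2 :=
    pdX_eq_of_hasDerivAt (x := p.1) (y := p.2) (by fun_prop)
      (by simpa using (hasDerivAt_id p.1).const_mul 2)
  have eYY : pdY (fun _ : ℝ × ℝ => (0 : ℝ)) p = 0 :=
    pdY_eq_of_hasDerivAt (x := p.1) (y := p.2) contDiff_const (hasDerivAt_const p.2 0)
  rw [eX, eY, eXX, eYY] at hle
  linarith

theorem hasDerivAt_gaussian_first (α a c t : ℝ) :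
    HasDerivAt (fun s => Real.exp (-α * ((s - a) ^ 2 + c)))
      (-2 * α * (t - a) * Real.exp (-α * ((t - a) ^ 2 + c))) t := by
  have h := (((((hasDerivAt_id t).sub_const a).pow 2).add_const c).const_mul (-α)).exp
  refine h.congr_deriv ?_
  simp
  ring

theorem hasDerivAt_gaussian_second (α a c t : ℝ) :
    HasDerivAt (fun s => -2 * α * (s - a) * Real.exp (-α * ((s - a) ^ 2 + c)))
      ((4 * α ^ 2 * (t - a) ^ 2 - 2 * α) * Real.exp (-α * ((t - a) ^ 2 + c))) t := by
  have h := (((hasDerivAt_id t).sub_const a).const_mul (-2 * α)).mul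
    (hasDerivAt_gaussian_first α a c t)
  refine h.congr_deriv ?_
  simp
  ring

theorem laplacian_gaussian (α a b k : ℝ) (p : ℝ × ℝ) :
    let h : ℝ × ℝ → ℝ := fun q => Real.exp (-α * ((q.1 - a) ^ 2 + (q.2 - b) ^ 2)) - k
    pdX (pdX h) p + pdY (pdY h) p =
      (4 * α ^ 2 * ((p.1 - a) ^ 2 + (p.2 - b) ^ 2) - 4 * α) *
        Real.exp (-α * ((p.1 - a) ^ 2 + (p.2 - b) ^ 2)) := by
  intro h
  have h1 : ContDiff ℝ 1 h := by fun_prop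
  have eX : pdX h = fun q =>
      -2 * α * (q.1 - a) * Real.exp (-α * ((q.1 - a) ^ 2 + (q.2 - b) ^ 2)) := by
    funext ⟨x, y⟩
    exact pdX_eq_of_hasDerivAt h1
      ((hasDerivAt_gaussian_first α a ((y - b) ^ 2) x).sub_const k)
  have eY : pdY h = fun q =>
      -2 * α * (q.2 - b) * Real.exp (-α * ((q.2 - b) ^ 2 + (q.1 - a) ^ 2)) := by
    funext ⟨x, y⟩
    refine pdY_eq_of_hasDerivAt h1 ?_
    simpa only [h, add_comm] using
      (hasDerivAt_gaussian_first α b ((x - a) ^ 2) y).sub_const k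
  obtain ⟨x, y⟩ := p
  rw [eX, eY,
    pdX_eq_of_hasDerivAt (by fun_prop) (hasDerivAt_gaussian_second α a ((y - b) ^ 2) x),
    pdY_eq_of_hasDerivAt (by fun_prop) (hasDerivAt_gaussian_second α b ((x - a) ^ 2) y),
    add_comm ((y - b) ^ 2)]
  ring

theorem dist_le_of_sq_add_sq_le {p q : ℝ × ℝ} {s : ℝ} (hs : 0 ≤ s)
    (h : (p.1 - q.1) ^ 2 + (p.2 - q.2) ^ 2 ≤ s ^ 2) : dist p q ≤ s := by
  rw [Prod.dist_eq, Real.dist_eq, Real.dist_eq, max_le_iff]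
  constructor <;> refine abs_le_of_sq_le_sq ?_ hs <;>
    nlinarith [sq_nonneg (p.1 - q.1), sq_nonneg (p.2 - q.2)]

/-- A local strong maximum principle: a nonpositive solution of `Δw ≥ M w` on a Euclidean disc
which is negative at the centre is negative on the open disc. -/
theorem neg_on_disc_of_neg_center {w : ℝ × ℝ → ℝ} (hw : ContDiff ℝ 2 w) {a b R M : ℝ}
    (hR : 0 < R) (hM : 0 ≤ M)
    (hle : ∀ p : ℝ × ℝ, (p.1 - a) ^ 2 + (p.2 - b) ^ 2 ≤ R → w p ≤ 0)
    (hlap : ∀ p : ℝ × ℝ, (p.1 - a) ^ 2 + (p.2 - b) ^ 2 ≤ R →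
      M * w p ≤ pdX (pdX w) p + pdY (pdY w) p)
    (hc : w (a, b) < 0) (p : ℝ × ℝ) (hp : (p.1 - a) ^ 2 + (p.2 - b) ^ 2 < R) : w p < 0 := by
  set N : ℝ × ℝ → ℝ := fun q => (q.1 - a) ^ 2 + (q.2 - b) ^ 2 with hN
  have hNc : Continuous N := by fun_prop
  have hcoord : ∀ q s, 0 ≤ s → N q ≤ s ^ 2 → dist q (a, b) ≤ s :=
    fun q s hs hq => dist_le_of_sq_add_sq_le hs hq
  obtain ⟨ρ, hρ, hρw⟩ : ∃ ρ > 0, ∀ q, N q ≤ ρ → w q ≤ w (a, b) / 2 := by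
    have hev : ∀ᶠ q in 𝓝 (a, b), w q ≤ w (a, b) / 2 := by
      filter_upwards [hw.continuous.continuousAt.eventually_lt_const
        (show w (a, b) < w (a, b) / 2 by linarith)] with q hq using hq.le
    obtain ⟨r, hr, hrw⟩ := Metric.eventually_nhds_iff.1 hev
    refine ⟨(r / 2) ^ 2, by positivity, fun q hq => hrw ?_⟩
    linarith [hcoord q (r / 2) (by positivity) hq]
  rcases le_or_gt (N p) ρ with hpρ | hpρ
  · linarith [hρw p hpρ]
  set α := 1 + (1 + M) / ρ with hα
  have hα1 : 1 ≤ α := by rw [hα]; linarith [show 0 ≤ (1 + M) / ρ by positivity]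
  have hαρ : 1 + M ≤ α * ρ := by
    rw [hα, add_mul, div_mul_cancel₀ _ hρ.ne']; linarith
  set h : ℝ × ℝ → ℝ := fun q => Real.exp (-α * N q) - Real.exp (-α * R) with hh
  have hhC : ContDiff ℝ 2 h := by simp only [hh, hN]; fun_prop
  have hh1 : ∀ q, h q ≤ 1 := by
    intro q
    have h₁ : Real.exp (-α * N q) ≤ 1 := by
      rw [Real.exp_le_one_iff]
      have : 0 ≤ N q := by simp only [hN]; positivity
      nlinarith
    have := Real.exp_pos (-α * R)
    simp only [hh]; linarith
  have hhlap : ∀ q, ρ ≤ N q → M * h q ≤ pdX (pdX h) q + pdY (pdY h) q := by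
    intro q hq
    have e := laplacian_gaussian α a b (Real.exp (-α * R)) q
    simp only at e
    simp only [hh, hN] at e ⊢
    rw [e]
    have hE := Real.exp_pos (-α * ((q.1 - a) ^ 2 + (q.2 - b) ^ 2))
    have hE' := Real.exp_pos (-α * R)
    have hq' : ρ ≤ (q.1 - a) ^ 2 + (q.2 - b) ^ 2 := hq
    have key : M ≤ 4 * α ^ 2 * ((q.1 - a) ^ 2 + (q.2 - b) ^ 2) - 4 * α := by
      have h₁ : α * (α * ρ) ≤ α * (α * ((q.1 - a) ^ 2 + (q.2 - b) ^ 2)) := by gcongr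
      nlinarith
    nlinarith [mul_le_mul_of_nonneg_right key hE.le, mul_nonneg hM hE'.le]
  set ε := -w (a, b) / 2 with hε
  have hε0 : 0 < ε := by rw [hε]; linarith
  set K : Set (ℝ × ℝ) := {q | ρ ≤ N q ∧ N q ≤ R}
  have hK : IsCompact K := by
    refine Metric.isCompact_of_isClosed_isBounded
      ((isClosed_le continuous_const hNc).inter (isClosed_le hNc continuous_const)) ?_
    refine (Metric.isBounded_closedBall (x := (a, b)) (r := √R)).subset fun q hq => ?_
    exact hcoord q _ (Real.sqrt_nonneg _) (by rw [Real.sq_sqrt hR.le]; exact hq.2)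
  have hmain : ∀ q ∈ K, w q + ε * h q ≤ 0 := by
    refine nonpos_of_laplacian_nonneg (hw.add (contDiff_const.mul hhC)) hK fun q hq hpos => ⟨?_, ?_⟩
    · have h₁ : ρ < N q := by
        refine lt_of_le_of_ne hq.1 fun he => ?_
        have := hρw q he.ge
        nlinarith [hh1 q]
      have h₂ : N q < R := by
        refine lt_of_le_of_ne hq.2 fun he => ?_
        have h₀ : h q = 0 := by simp only [hh, he, sub_self]
        rw [h₀] at hpos
        linarith [hle q hq.2]
      filter_upwards [hNc.continuousAt.eventually_const_lt h₁,
        hNc.continuousAt.eventually_lt_const h₂] with r hr₁ hr₂ using ⟨hr₁.le, hr₂.le⟩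
    · rw [laplacian_add_smul hw hhC]
      have h₁ := hlap q hq.2
      have h₂ := mul_le_mul_of_nonneg_left (hhlap q hq.1) hε0.le
      nlinarith [mul_nonneg hM hpos.le]
  have hhp : 0 < h p := by
    simp only [hh, sub_pos, Real.exp_lt_exp]
    have : N p < R := hp
    nlinarith
  have := hmain p ⟨hpρ.le, le_of_lt hp⟩
  nlinarith [mul_pos hε0 hhp]

end MaximumPrinciple

section OneSidedDerivatives

open Filter Topology

theorem HasDerivAt.nonneg_of_eventually_right {f : ℝ → ℝ} {f' a : ℝ} (h : HasDerivAt f f' a)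
    (hf : ∀ᶠ t in 𝓝[>] a, f a ≤ f t) : 0 ≤ f' := by
  have ht : Tendsto (slope f a) (𝓝[>] a) (𝓝 f') :=
    (hasDerivAt_iff_tendsto_slope.1 h).mono_left (nhdsWithin_mono _ fun t ht => ne_of_gt ht)
  refine ge_of_tendsto ht ?_
  filter_upwards [hf, self_mem_nhdsWithin] with t h₁ h₂
  rw [slope_def_field]
  exact div_nonneg (sub_nonneg.2 h₁) (sub_nonneg.2 (le_of_lt h₂))

theorem HasDerivAt.nonneg_of_eventually_left {f : ℝ → ℝ} {f' a : ℝ} (h : HasDerivAt f f' a)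
    (hf : ∀ᶠ t in 𝓝[<] a, f t ≤ f a) : 0 ≤ f' := by
  have ht : Tendsto (slope f a) (𝓝[<] a) (𝓝 f') :=
    (hasDerivAt_iff_tendsto_slope.1 h).mono_left (nhdsWithin_mono _ fun t ht => ne_of_lt ht)
  refine ge_of_tendsto ht ?_
  filter_upwards [hf, self_mem_nhdsWithin] with t h₁ h₂
  rw [slope_def_field]
  exact div_nonneg_of_nonpos (sub_nonpos.2 h₁) (sub_nonpos.2 (le_of_lt h₂))

theorem HasDerivAt.eq_zero_of_reflection {f : ℝ → ℝ} {f' a : ℝ} (h : HasDerivAt f f' a)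
    (hf : ∀ t, f (2 * a - t) = f t) : f' = 0 := by
  have h₁ : HasDerivAt f f' (2 * a - a) := by
    rw [show 2 * a - a = a by ring]; exact h
  have h₂ := h₁.comp a ((hasDerivAt_id a).const_sub (2 * a))
  have e : f ∘ (2 * a - ·) = f := funext hf
  rw [e] at h₂
  have := h.unique h₂
  linarith

end OneSidedDerivatives

namespace PeriodicWave

open Filter Topology

variable {g Patm L : ℝ} (W : PeriodicWave g Patm L)

theorem contDiff_pdX_u : ContDiff ℝ 2 (pdX W.u) :=
  contDiff_pdX (W.u_smooth.of_le (by norm_num))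

theorem contDiff_pdY_u : ContDiff ℝ 2 (pdY W.u) :=
  contDiff_pdY (W.u_smooth.of_le (by norm_num))

theorem contDiff_pdX_v : ContDiff ℝ 2 (pdX W.v) :=
  contDiff_pdX (W.v_smooth.of_le (by norm_num))

theorem contDiff_pdY_v : ContDiff ℝ 2 (pdY W.v) :=
  contDiff_pdY (W.v_smooth.of_le (by norm_num))

theorem u_neg {x y : ℝ} (h₁ : -W.d ≤ y) (h₂ : y ≤ W.η x) : W.u (x, y) < 0 := by
  obtain ⟨δ, hδ, h⟩ := W.nonstagnant
  linarith [h x y h₁ h₂]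

theorem bed_lt_surface (hL : 0 < L) (x : ℝ) : -W.d < W.η x := by
  have hne : ∀ x, W.η x ≠ -W.d := fun x hx => by
    have h₁ := W.psi_surface x
    rw [hx, W.psi_bed] at h₁
    exact W.m_pos.ne' h₁
  have hcont := W.η_smooth.continuous
  obtain ⟨z, hz⟩ : ∃ z, 0 ≤ W.η z := by
    by_contra! hneg
    have hpos : 0 < ∫ x in (-L)..L, -W.η x :=
      intervalIntegral.intervalIntegral_pos_of_pos (hcont.neg.intervalIntegrable _ _)
        (fun x => neg_pos.2 (hneg x)) (by linarith)
    rw [intervalIntegral.integral_neg, W.η_mean] at hpos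
    simp at hpos
  by_contra! hx
  obtain ⟨t, ht⟩ := mem_range_of_exists_le_of_exists_ge hcont ⟨x, hx⟩
    ⟨z, (by linarith [W.d_pos] : -W.d ≤ W.η z)⟩
  exact hne t ht

theorem psi_strictAntiOn (x : ℝ) :
    StrictAntiOn (fun y => W.ψ (x, y)) (Icc (-W.d) (W.η x)) := by
  have hd (y : ℝ) := hasDerivAt_slice_snd (W.ψ_smooth.of_le (by norm_num)) x y
  refine strictAntiOn_of_deriv_neg (convex_Icc _ _)
    (fun y _ => (hd y).continuousAt.continuousWithinAt) fun y hy => ?_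
  rw [interior_Icc] at hy
  rw [(hd y).deriv, W.psi_y x y hy.1.le hy.2.le]
  exact W.u_neg hy.1.le hy.2.le

theorem psi_mem_Ioo {x y : ℝ} (h₁ : -W.d < y) (h₂ : y < W.η x) :
    W.ψ (x, y) ∈ Ioo 0 W.m := by
  have h := W.psi_strictAntiOn x
  have h₃ : -W.d ≤ W.η x := (h₁.trans h₂).le
  constructor
  · simpa [W.psi_surface] using h ⟨h₁.le, h₂.le⟩ (right_mem_Icc.2 h₃) h₂
  · simpa [W.psi_bed] using h (left_mem_Icc.2 h₃) ⟨h₁.le, h₂.le⟩ h₁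

/-- The derivative of the vorticity function on `[0, m]`. -/
noncomputable def γ' (s : ℝ) : ℝ := derivWithin W.γ (Icc 0 W.m) s

theorem contDiffOn_γ' : ContDiffOn ℝ 1 W.γ' (Icc 0 W.m) :=
  W.γ_smooth.derivWithin (uniqueDiffOn_Icc W.m_pos) (by norm_num)

theorem hasDerivAt_γ {s : ℝ} (hs : s ∈ Ioo 0 W.m) : HasDerivAt W.γ (W.γ' s) s :=
  ((W.γ_smooth.differentiableOn (by norm_num)) s
    (Ioo_subset_Icc_self hs)).hasDerivWithinAt.hasDerivAt (Icc_mem_nhds hs.1 hs.2)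

theorem hasDerivAt_γ' {s : ℝ} (hs : s ∈ Ioo 0 W.m) :
    HasDerivAt W.γ' (derivWithin W.γ' (Icc 0 W.m) s) s :=
  ((W.contDiffOn_γ'.differentiableOn one_ne_zero) s
    (Ioo_subset_Icc_self hs)).hasDerivWithinAt.hasDerivAt (Icc_mem_nhds hs.1 hs.2)

theorem hasDerivAt_psi_fst {x y : ℝ} (h₁ : -W.d ≤ y) (h₂ : y ≤ W.η x) :
    HasDerivAt (fun t => W.ψ (t, y)) (-W.v (x, y)) x := by
  rw [← W.psi_x x y h₁ h₂]
  exact hasDerivAt_slice_fst (W.ψ_smooth.of_le (by norm_num)) x y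

theorem hasDerivAt_psi_snd {x y : ℝ} (h₁ : -W.d ≤ y) (h₂ : y ≤ W.η x) :
    HasDerivAt (fun t => W.ψ (x, t)) (W.u (x, y)) y := by
  rw [← W.psi_y x y h₁ h₂]
  exact hasDerivAt_slice_snd (W.ψ_smooth.of_le (by norm_num)) x y

theorem eventually_slice_fst {x y : ℝ} (h₁ : -W.d < y) (h₂ : y < W.η x) :
    ∀ᶠ t in 𝓝 x, -W.d < y ∧ y < W.η t :=
  (W.η_smooth.continuous.continuousAt.eventually_const_lt h₂).mono fun _ h => ⟨h₁, h⟩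

theorem eventually_slice_snd {x y : ℝ} (h₁ : -W.d < y) (h₂ : y < W.η x) :
    ∀ᶠ t in 𝓝 y, -W.d < t ∧ t < W.η x :=
  Ioo_mem_nhds h₁ h₂

theorem laplacian_u {x y : ℝ} (h₁ : -W.d < y) (h₂ : y < W.η x) :
    pdX (pdX W.u) (x, y) + pdY (pdY W.u) (x, y) = -(W.γ' (W.ψ (x, y)) * W.u (x, y)) := by
  have hvort : pdY (pdX W.v) (x, y) - pdY (pdY W.u) (x, y) =
      W.γ' (W.ψ (x, y)) * W.u (x, y) := by
    have ha := (hasDerivAt_slice_snd (W.contDiff_pdX_v.of_le (by norm_num)) x y).sub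
      (hasDerivAt_slice_snd (W.contDiff_pdY_u.of_le (by norm_num)) x y)
    have hb := (W.hasDerivAt_γ (W.psi_mem_Ioo h₁ h₂)).comp y (W.hasDerivAt_psi_snd h₁.le h₂.le)
    refine ha.unique (hb.congr_of_eventuallyEq ?_)
    filter_upwards [W.eventually_slice_snd h₁ h₂] with t ht using W.vorticity_eq x t ht.1 ht.2
  have hdiv : pdX (pdX W.u) (x, y) + pdX (pdY W.v) (x, y) = 0 := by
    have ha := (hasDerivAt_slice_fst (W.contDiff_pdX_u.of_le (by norm_num)) x y).add
      (hasDerivAt_slice_fst (W.contDiff_pdY_v.of_le (by norm_num)) x y)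
    refine ha.unique ((hasDerivAt_const x (0 : ℝ)).congr_of_eventuallyEq ?_)
    filter_upwards [W.eventually_slice_fst h₁ h₂] with t ht using W.incompressible t y ht.1 ht.2
  rw [pdX_pdY_comm (W.v_smooth.of_le (by norm_num))] at hdiv
  linarith

theorem laplacian_pdX_u {x y : ℝ} (h₁ : -W.d < y) (h₂ : y < W.η x) :
    pdX (pdX (pdX W.u)) (x, y) + pdY (pdY (pdX W.u)) (x, y) =
      derivWithin W.γ' (Icc 0 W.m) (W.ψ (x, y)) * W.v (x, y) * W.u (x, y) -
        W.γ' (W.ψ (x, y)) * pdX W.u (x, y) := by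
  have ha := (hasDerivAt_slice_fst (contDiff_pdX W.contDiff_pdX_u) x y).add
    (hasDerivAt_slice_fst (contDiff_pdY W.contDiff_pdY_u) x y)
  have hb := (((W.hasDerivAt_γ' (W.psi_mem_Ioo h₁ h₂)).comp x
    (W.hasDerivAt_psi_fst h₁.le h₂.le)).mul
      (hasDerivAt_slice_fst (W.u_smooth.of_le (by norm_num)) x y)).neg
  have e := ha.unique (hb.congr_of_eventuallyEq (by
    filter_upwards [W.eventually_slice_fst h₁ h₂] with t ht using W.laplacian_u ht.1 ht.2))
  rw [pdX_pdY_comm W.contDiff_pdY_u, pdX_pdY_comm (W.u_smooth.of_le (by norm_num))] at e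
  rw [e]
  simp only [Function.comp]
  ring

theorem pdX_u_crest (y : ℝ) : pdX W.u (0, y) = 0 :=
  (hasDerivAt_slice_fst (W.u_smooth.of_le (by norm_num)) 0 y).eq_zero_of_reflection
    fun t => by simpa using W.u_even t y

theorem pdX_u_trough (y : ℝ) : pdX W.u (L, y) = 0 :=
  (hasDerivAt_slice_fst (W.u_smooth.of_le (by norm_num)) L y).eq_zero_of_reflection
    fun t => by rw [← W.u_even t y, ← W.u_periodic (-t) y, neg_add_eq_sub]

theorem tendsto_surface (x : ℝ) :
    Tendsto (fun t : ℝ => (x, t)) (𝓝[<] W.η x) (𝓝 (x, W.η x)) :=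
  ((show Continuous fun t : ℝ => (x, t) by fun_prop).tendsto _).mono_left nhdsWithin_le_nhds

theorem eventually_below_surface (hL : 0 < L) (x : ℝ) :
    ∀ᶠ t in 𝓝[<] W.η x, -W.d < t ∧ t < W.η x :=
  Ioo_mem_nhdsLT (W.bed_lt_surface hL x)

theorem surface_nonpos (hL : 0 < L) {f : ℝ × ℝ → ℝ} (hf : Continuous f)
    (h : ∀ x y, -W.d < y → y < W.η x → f (x, y) ≤ 0) (x : ℝ) : f (x, W.η x) ≤ 0 :=
  le_of_tendsto ((hf.tendsto _).comp (W.tendsto_surface x)) <|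
    (W.eventually_below_surface hL x).mono fun t ht => h x t ht.1 ht.2

theorem surface_eq_zero (hL : 0 < L) {f : ℝ × ℝ → ℝ} (hf : Continuous f)
    (h : ∀ x y, -W.d < y → y < W.η x → f (x, y) = 0) (x : ℝ) : f (x, W.η x) = 0 :=
  le_antisymm (W.surface_nonpos hL hf (fun x y h₁ h₂ => (h x y h₁ h₂).le) x) <| by
    exact neg_nonpos.1 <| W.surface_nonpos hL (f := fun p => -f p) hf.neg
      (fun x y h₁ h₂ => by rw [h x y h₁ h₂, neg_zero]) x

theorem isOpen_Ωplus : IsOpen W.Ωplus := by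
  have := W.η_smooth.continuous
  exact (isOpen_lt continuous_const continuous_fst).inter <|
    (isOpen_lt continuous_fst continuous_const).inter <|
      (isOpen_lt continuous_const continuous_snd).inter <|
        isOpen_lt continuous_snd (by fun_prop)

theorem surface_incompressible (hL : 0 < L) (x : ℝ) :
    pdX W.u (x, W.η x) + pdY W.v (x, W.η x) = 0 :=
  W.surface_eq_zero hL (W.contDiff_pdX_u.continuous.add W.contDiff_pdY_v.continuous)
    W.incompressible x

theorem surface_vorticity (hL : 0 < L) (x : ℝ) :
    pdX W.v (x, W.η x) - pdY W.u (x, W.η x) = W.γ 0 := by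
  have h₁ : Tendsto (fun t => pdX W.v (x, t) - pdY W.u (x, t)) (𝓝[<] W.η x)
      (𝓝 (pdX W.v (x, W.η x) - pdY W.u (x, W.η x))) :=
    ((W.contDiff_pdX_v.continuous.sub W.contDiff_pdY_u.continuous).tendsto _).comp
      (W.tendsto_surface x)
  have h₂ : Tendsto (fun t => W.ψ (x, t)) (𝓝[<] W.η x) (𝓝[Icc 0 W.m] 0) := by
    refine tendsto_nhdsWithin_iff.2 ⟨?_, ?_⟩
    · rw [← W.psi_surface x]
      exact (W.ψ_smooth.continuous.tendsto _).comp (W.tendsto_surface x)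
    · exact (W.eventually_below_surface hL x).mono fun t ht =>
        Ioo_subset_Icc_self (W.psi_mem_Ioo ht.1 ht.2)
  have h₃ := (W.γ_smooth.continuousOn 0 (left_mem_Icc.2 W.m_pos.le)).tendsto.comp h₂
  refine tendsto_nhds_unique (h₁.congr' ?_) h₃
  filter_upwards [W.eventually_below_surface hL x] with t ht using W.vorticity_eq x t ht.1 ht.2

/-- The derivative of Bernoulli's law along the free surface, in terms of `u`, `v`, `u_x`
and `u_y` only. -/
theorem surface_bernoulli (hL : 0 < L) (x : ℝ) :
    (W.u (x, W.η x) ^ 2 - W.v (x, W.η x) ^ 2) * pdX W.u (x, W.η x) +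
      W.v (x, W.η x) * (W.u (x, W.η x) * (2 * pdY W.u (x, W.η x) + W.γ 0) + g) = 0 := by
  have cu := W.u_smooth.continuous
  have cv := W.v_smooth.continuous
  have cux := W.contDiff_pdX_u.continuous
  have cuy := W.contDiff_pdY_u.continuous
  have cvx := W.contDiff_pdX_v.continuous
  have cvy := W.contDiff_pdY_v.continuous
  have hP : ContDiff ℝ 1 W.P := W.P_smooth.of_le (by norm_num)
  have cPx : Continuous (pdX W.P) := (contDiff_pdX (n := 0) (by simpa using hP)).continuous
  have cPy : Continuous (pdY W.P) := (contDiff_pdY (n := 0) (by simpa using hP)).continuous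
  have ex := W.surface_eq_zero hL
    (f := fun p => W.u p * pdX W.u p + W.v p * pdY W.u p + pdX W.P p) (by fun_prop)
    (fun x y h₁ h₂ => by linarith [W.euler_x x y h₁ h₂]) x
  have ey := W.surface_eq_zero hL
    (f := fun p => W.u p * pdX W.v p + W.v p * pdY W.v p + pdY W.P p + g) (by fun_prop)
    (fun x y h₁ h₂ => by linarith [W.euler_y x y h₁ h₂]) x
  have hη : HasDerivAt W.η (deriv W.η x) x :=
    (W.η_smooth.differentiable (by norm_num) x).hasDerivAt
  have hp := hasDerivAt_along_curve hP (hasDerivAt_id x) hη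
  have e : (fun s => W.P (id s, W.η s)) = fun _ => Patm := funext W.surface_pressure
  rw [e] at hp
  have hp0 := hp.unique (hasDerivAt_const x Patm)
  have hk := W.surface_kinematic x
  have hi := W.surface_incompressible hL x
  have hv := W.surface_vorticity hL x
  simp only [id] at hp0 ex ey
  set a := W.u (x, W.η x)
  set b := W.v (x, W.η x)
  set ux := pdX W.u (x, W.η x)
  set uy := pdY W.u (x, W.η x)
  set vx := pdX W.v (x, W.η x)
  set vy := pdY W.v (x, W.η x)
  have hvx : vx = uy + W.γ 0 := by linarith
  have hvy : vy = -ux := by linarith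
  rw [hvx, hvy] at ey
  linear_combination a * ex + b * ey - a * hp0 - pdY W.P (x, W.η x) * hk

theorem surface_laplacian_u_nonpos (hL : 0 < L) (hγ' : ∀ s ∈ Icc 0 W.m, W.γ' s ≤ 0) (x : ℝ) :
    pdX (pdX W.u) (x, W.η x) + pdY (pdY W.u) (x, W.η x) ≤ 0 := by
  have hx : ContDiff ℝ 1 (pdX (pdX W.u)) := contDiff_pdX W.contDiff_pdX_u
  have hy : ContDiff ℝ 1 (pdY (pdY W.u)) := contDiff_pdY W.contDiff_pdY_u
  refine W.surface_nonpos hL (hx.continuous.add hy.continuous) (fun x y h₁ h₂ => ?_) x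
  have e := W.laplacian_u h₁ h₂
  rw [Pi.add_apply, e]
  nlinarith [mul_nonneg_of_nonpos_of_nonpos
    (hγ' _ (Ioo_subset_Icc_self (W.psi_mem_Ioo h₁ h₂))) (W.u_neg h₁.le h₂.le).le]

variable {W}

theorem MonotoneHalf.pdX_u_nonpos_bed (hmono : W.MonotoneHalf) (hL : 0 < L) {x : ℝ}
    (h₀ : 0 < x) (h₁ : x < L) : pdX W.u (x, -W.d) ≤ 0 := by
  have hbed := W.bed_lt_surface hL x
  have hvy : 0 ≤ pdY W.v (x, -W.d) := by
    refine (hasDerivAt_slice_snd (W.v_smooth.of_le (by norm_num)) x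
      (-W.d)).nonneg_of_eventually_right ?_
    filter_upwards [Ioo_mem_nhdsGT hbed] with t ht
    rw [W.bed_kinematic]
    exact (hmono _ (Or.inl ⟨h₀, h₁, ht.1, ht.2⟩)).le
  have ht : Tendsto (fun t => pdX W.u (x, t) + pdY W.v (x, t)) (𝓝[>] (-W.d))
      (𝓝 (pdX W.u (x, -W.d) + pdY W.v (x, -W.d))) :=
    ((W.contDiff_pdX_u.continuous.add W.contDiff_pdY_v.continuous).comp
      (show Continuous fun t : ℝ => (x, t) by fun_prop)).continuousWithinAt
  have hdiv : pdX W.u (x, -W.d) + pdY W.v (x, -W.d) = 0 := by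
    refine tendsto_nhds_unique (ht.congr' ?_) tendsto_const_nhds
    filter_upwards [Ioo_mem_nhdsGT hbed] with t ht using W.incompressible x t ht.1 ht.2
  linarith

theorem MonotoneHalf.le_laplacian_pdX_u (hmono : W.MonotoneHalf)
    (hγ'' : ∀ s ∈ Icc 0 W.m, derivWithin W.γ' (Icc 0 W.m) s ≤ 0) {p : ℝ × ℝ} (hp : p ∈ W.Ωplus) :
    -W.γ' (W.ψ p) * pdX W.u p ≤ pdX (pdX (pdX W.u)) p + pdY (pdY (pdX W.u)) p := by
  obtain ⟨x, y⟩ := p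
  obtain ⟨h₀, h₁, h₂, h₃⟩ := id hp
  simp only at h₀ h₁ h₂ h₃
  rw [W.laplacian_pdX_u h₂ h₃]
  have := mul_nonneg_of_nonpos_of_nonpos (mul_nonpos_of_nonpos_of_nonneg
    (hγ'' _ (Ioo_subset_Icc_self (W.psi_mem_Ioo h₂ h₃))) (hmono _ (Or.inl hp)).le)
    (W.u_neg h₂.le h₃.le).le
  linarith

theorem MonotoneHalf.pdX_u_nonpos (hmono : W.MonotoneHalf) (hL : 0 < L)
    (hγ' : ∀ s ∈ Icc 0 W.m, W.γ' s ≤ 0)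
    (hγ'' : ∀ s ∈ Icc 0 W.m, derivWithin W.γ' (Icc 0 W.m) s ≤ 0)
    (hux : ∀ p ∈ W.Splus, pdX W.u p ≤ 0) {p : ℝ × ℝ} (hp : p ∈ W.Ωplus) : pdX W.u p ≤ 0 := by
  set K : Set (ℝ × ℝ) := {p | 0 ≤ p.1 ∧ p.1 ≤ L ∧ -W.d ≤ p.2 ∧ p.2 ≤ W.η p.1}
  have hη := W.η_smooth.continuous
  have hsub : W.Ωplus ⊆ K := fun q hq => ⟨hq.1.le, hq.2.1.le, hq.2.2.1.le, hq.2.2.2.le⟩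
  have hK : IsCompact K := by
    obtain ⟨B, hB⟩ := (isCompact_Icc (a := 0) (b := L)).bddAbove_image hη.continuousOn
    have hbox := (isCompact_Icc (a := 0) (b := L)).prod (isCompact_Icc (a := -W.d) (b := B))
    refine hbox.of_isClosed_subset ?_ fun q hq =>
      ⟨⟨hq.1, hq.2.1⟩, hq.2.2.1, hq.2.2.2.trans (hB ⟨q.1, ⟨hq.1, hq.2.1⟩, rfl⟩)⟩
    exact (isClosed_le continuous_const continuous_fst).inter <|
      (isClosed_le continuous_fst continuous_const).inter <|
        (isClosed_le continuous_const continuous_snd).inter <|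
          isClosed_le continuous_snd (by fun_prop)
  refine nonpos_of_laplacian_nonneg W.contDiff_pdX_u hK ?_ p (hsub hp)
  rintro ⟨x, y⟩ ⟨h₀, h₁, h₂, h₃⟩ hpos
  simp only at h₀ h₁ h₂ h₃
  have h₀' : 0 < x := h₀.lt_of_ne fun h => by
    rw [← h, W.pdX_u_crest] at hpos; exact lt_irrefl _ hpos
  have h₁' : x < L := h₁.lt_of_ne fun h => by
    rw [h, W.pdX_u_trough] at hpos; exact lt_irrefl _ hpos
  have h₂' : -W.d < y := h₂.lt_of_ne fun h => by
    rw [← h] at hpos; exact hpos.not_ge (hmono.pdX_u_nonpos_bed hL h₀' h₁')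
  have h₃' : y < W.η x := h₃.lt_of_ne fun h => hpos.not_ge (hux _ ⟨h₀', h₁', h⟩)
  have hmem : (x, y) ∈ W.Ωplus := ⟨h₀', h₁', h₂', h₃'⟩
  refine ⟨mem_of_superset (W.isOpen_Ωplus.mem_nhds hmem) hsub,
    le_trans ?_ (hmono.le_laplacian_pdX_u hγ'' hmem)⟩
  exact mul_nonneg
    (neg_nonneg.2 (hγ' _ (Ioo_subset_Icc_self (W.psi_mem_Ioo h₂' h₃')))) hpos.le

theorem MonotoneHalf.pdX_u_neg (hmono : W.MonotoneHalf) (hL : 0 < L)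
    (hγ' : ∀ s ∈ Icc 0 W.m, W.γ' s ≤ 0)
    (hγ'' : ∀ s ∈ Icc 0 W.m, derivWithin W.γ' (Icc 0 W.m) s ≤ 0)
    (hux : ∀ p ∈ W.Splus, pdX W.u p ≤ 0) {p : ℝ × ℝ} (hp : p ∈ W.Ωplus) : pdX W.u p < 0 := by
  obtain ⟨x, y⟩ := p
  obtain ⟨h₀, h₁, h₂, h₃⟩ := id hp
  simp only at h₀ h₁ h₂ h₃
  have hw := W.contDiff_pdX_u
  obtain ⟨B, hB⟩ := (isCompact_Icc (a := 0) (b := W.m)).bddBelow_image W.contDiffOn_γ'.continuousOn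
  have hB' : ∀ s ∈ Icc 0 W.m, B ≤ W.γ' s := fun s hs => hB ⟨s, hs, rfl⟩
  have hB0 : B ≤ 0 := by
    have h0 := left_mem_Icc.2 W.m_pos.le
    exact (hB' 0 h0).trans (hγ' 0 h0)
  have hnonpos : ∀ q ∈ W.Ωplus, pdX W.u q ≤ 0 :=
    fun q hq => hmono.pdX_u_nonpos hL hγ' hγ'' hux hq
  have hlap : ∀ q ∈ W.Ωplus,
      -B * pdX W.u q ≤ pdX (pdX (pdX W.u)) q + pdY (pdY (pdX W.u)) q := by
    intro q hq
    refine le_trans ?_ (hmono.le_laplacian_pdX_u hγ'' hq)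
    have := hB' _ (Ioo_subset_Icc_self (W.psi_mem_Ioo (x := q.1) (y := q.2) hq.2.2.1 hq.2.2.2))
    nlinarith [hnonpos q hq]
  set U : Set ℝ := {t | pdX W.u (x, t) < 0}
  have hslice : Continuous fun t : ℝ => (x, t) := by fun_prop
  have hU : IsOpen U := isOpen_lt (hw.continuous.comp hslice) continuous_const
  suffices hIoo : Ioo (-W.d) (W.η x) ⊆ U ∩ Ioo (-W.d) (W.η x) from (hIoo ⟨h₂, h₃⟩).1
  refine isPreconnected_Ioo.subset_of_closure_inter_subset (hU.inter isOpen_Ioo) ?_ ?_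
  · have hv (t : ℝ) := hasDerivAt_slice_snd (W.v_smooth.of_le (by norm_num)) x t
    obtain ⟨c, hc, hslope⟩ := exists_hasDerivAt_eq_slope (fun t => W.v (x, t)) _ h₂
      (fun t _ => (hv t).continuousAt.continuousWithinAt) fun t _ => hv t
    have hcη := hc.2.trans h₃
    have hpos : 0 < pdY W.v (x, c) := by
      rw [hslope, W.bed_kinematic, sub_zero]
      exact div_pos (hmono _ (Or.inl hp)) (by linarith)
    refine ⟨c, ⟨hc.1, hcη⟩, ?_, hc.1, hcη⟩
    have := W.incompressible x c hc.1 hcη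
    change pdX W.u (x, c) < 0
    linarith
  · rintro t ⟨ht, htI⟩
    refine ⟨?_, htI⟩
    have hmem : (x, t) ∈ W.Ωplus := ⟨h₀, h₁, htI.1, htI.2⟩
    obtain ⟨r, hr, hball⟩ := Metric.isOpen_iff.1 W.isOpen_Ωplus _ hmem
    obtain ⟨c, ⟨hcU, -⟩, hdist⟩ := Metric.mem_closure_iff.1 ht (r / 3) (by positivity)
    rw [Real.dist_eq] at hdist
    have hdisc : ∀ q : ℝ × ℝ, (q.1 - x) ^ 2 + (q.2 - c) ^ 2 ≤ (r / 3) ^ 2 → q ∈ W.Ωplus := by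
      intro q hq
      refine hball (Metric.mem_ball.2 ?_)
      have hqc : dist q (x, c) ≤ r / 3 := dist_le_of_sq_add_sq_le (by positivity) hq
      have hct : dist (x, c) (x, t) ≤ r / 3 := by
        refine dist_le_of_sq_add_sq_le (by positivity) ?_
        have := sq_lt_sq' (abs_lt.1 hdist).1 (abs_lt.1 hdist).2
        simp only
        nlinarith
      linarith [dist_triangle q (x, c) (x, t)]
    refine neg_on_disc_of_neg_center hw (R := (r / 3) ^ 2) (by positivity)
      (neg_nonneg.2 hB0) (fun q hq => hnonpos q (hdisc q hq)) (fun q hq => hlap q (hdisc q hq))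
      hcU (x, t) ?_
    have := sq_lt_sq' (abs_lt.1 hdist).1 (abs_lt.1 hdist).2
    simpa using this

/-- At a surface point where `u_x` vanishes, two differentiations of the dynamic boundary
condition force `u_xy < 0`, which is incompatible with `u_x ≤ 0` below the surface. -/
theorem MonotoneHalf.pdX_u_neg_surface (hmono : W.MonotoneHalf) (hg : 0 < g) (hL : 0 < L)
    (hγ : W.γ 0 ≤ 0) (hγ' : ∀ s ∈ Icc 0 W.m, W.γ' s ≤ 0)
    (hux : ∀ p ∈ W.Splus, pdX W.u p ≤ 0) (hΩ : ∀ p ∈ W.Ωplus, pdX W.u p ≤ 0)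
    {x : ℝ} (h₀ : 0 < x) (h₁ : x < L) : pdX W.u (x, W.η x) < 0 := by
  refine (hux _ ⟨h₀, h₁, rfl⟩).lt_of_ne fun hzero => ?_
  have hu1 : ContDiff ℝ 1 W.u := W.u_smooth.of_le (by norm_num)
  have hv1 : ContDiff ℝ 1 W.v := W.v_smooth.of_le (by norm_num)
  have hux1 : ContDiff ℝ 1 (pdX W.u) := W.contDiff_pdX_u.of_le (by norm_num)
  have huy1 : ContDiff ℝ 1 (pdY W.u) := W.contDiff_pdY_u.of_le (by norm_num)
  have hη : HasDerivAt W.η (deriv W.η x) x :=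
    (W.η_smooth.differentiable (by norm_num) x).hasDerivAt
  have hu := W.u_neg (W.bed_lt_surface hL x).le le_rfl
  have hv : 0 < W.v (x, W.η x) := hmono _ (Or.inr ⟨h₀, h₁, rfl⟩)
  have huxy : 0 ≤ pdY (pdX W.u) (x, W.η x) := by
    refine (hasDerivAt_slice_snd hux1 x (W.η x)).nonneg_of_eventually_left ?_
    filter_upwards [W.eventually_below_surface hL x] with t ht
    rw [hzero]
    exact hΩ _ ⟨h₀, h₁, ht.1, ht.2⟩
  have du := hasDerivAt_along_curve hu1 (hasDerivAt_id x) hη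
  have dv := hasDerivAt_along_curve hv1 (hasDerivAt_id x) hη
  have dux := hasDerivAt_along_curve hux1 (hasDerivAt_id x) hη
  have duy := hasDerivAt_along_curve huy1 (hasDerivAt_id x) hη
  have htan : 1 * pdX (pdX W.u) (x, W.η x) + deriv W.η x * pdY (pdX W.u) (x, W.η x) = 0 := by
    refine IsLocalMax.hasDerivAt_eq_zero ?_ dux
    filter_upwards [Ioo_mem_nhds h₀ h₁] with t ht
    simp only [id, hzero]
    exact hux _ ⟨ht.1, ht.2, rfl⟩
  have hF := ((((du.pow 2).sub (dv.pow 2)).mul dux).add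
    (dv.mul ((du.mul ((duy.const_mul 2).add_const (W.γ 0))).add_const g)))
  have hF0 := hF.unique ((hasDerivAt_const x (0 : ℝ)).congr_of_eventuallyEq
    (Eventually.of_forall fun t => W.surface_bernoulli hL t))
  have hB := W.surface_bernoulli hL x
  have hk := W.surface_kinematic x
  have hlap := W.surface_laplacian_u_nonpos hL hγ' x
  rw [pdX_pdY_comm (W.u_smooth.of_le (by norm_num))] at hF0
  simp only [id, Pi.mul_apply, htan, hzero] at hF0 hB
  set a := W.u (x, W.η x)
  set b := W.v (x, W.η x)
  set uy := pdY W.u (x, W.η x)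
  set uxx := pdX (pdX W.u) (x, W.η x)
  set uxy := pdY (pdX W.u) (x, W.η x)
  set uyy := pdY (pdY W.u) (x, W.η x)
  set e := deriv W.η x
  have hB' : a * (2 * uy + W.γ 0) + g = 0 := by
    have : b * (a * (2 * uy + W.γ 0) + g) = 0 := by linarith
    exact (mul_eq_zero.1 this).resolve_left hv.ne'
  have hpos : 0 < 2 * uy + W.γ 0 := by
    by_contra! hle
    nlinarith [mul_nonneg_of_nonpos_of_nonpos hu.le hle]
  have huy : 0 < uy := by linarith
  have he : e < 0 := by
    by_contra! hle
    nlinarith [mul_nonpos_of_nonneg_of_nonpos hle hu.le]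
  have hT : e * uy * (2 * uy + W.γ 0) + 2 * a * (uxy + e * uyy) = 0 := by
    have : b * (e * uy * (2 * uy + W.γ 0) + 2 * a * (uxy + e * uyy)) = 0 := by
      linear_combination hF0 - (1 * pdX W.v (x, W.η x) + e * pdY W.v (x, W.η x)) * hB'
    exact (mul_eq_zero.1 this).resolve_left hv.ne'
  have h₂ : e * uy * (2 * uy + W.γ 0) < 0 :=
    mul_neg_of_neg_of_pos (mul_neg_of_neg_of_pos he huy) hpos
  have h₃ : 0 ≤ uxy + e * uyy := by
    have : uyy ≤ e * uxy := by linarith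
    have := mul_le_mul_of_nonpos_left this he.le
    nlinarith [mul_nonneg (sq_nonneg e) huxy]
  nlinarith [mul_nonpos_of_nonpos_of_nonneg hu.le h₃]

end PeriodicWave

/-- **Lemma (strict sign of `u_x` for waves in `𝒲₀`).**  Every nontrivial periodic wave
in `𝒲₀` (that is, a nontrivial wave in `𝒲` with `u_x ≤ 0` on `S⁺`) satisfies the strict
inequality `u_x < 0` at every point of `Ω⁺ ∪ S⁺`. -/
theorem periodic_ux_neg_of_ux_nonpos (g Patm L : ℝ) (hg : 0 < g) (hL : 0 < L)
    (W : PeriodicWave g Patm L) (hMW : W.MemW) (hnt : ¬W.IsTrivial)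
    (hux : ∀ p ∈ W.Splus, pdX W.u p ≤ 0) :
    ∀ p ∈ W.Ωplus ∪ W.Splus, pdX W.u p < 0 := by
  obtain ⟨hγ, hγ', hγ'', htriv⟩ := hMW
  have hmono : W.MonotoneHalf := htriv.resolve_left hnt
  have hΩ : ∀ p ∈ W.Ωplus, pdX W.u p < 0 :=
    fun p hp => hmono.pdX_u_neg hL hγ' hγ'' hux hp
  rintro ⟨x, y⟩ (hp | ⟨h₀, h₁, h₂⟩)
  · exact hΩ _ hp
  · simp only at h₀ h₁ h₂
    subst h₂
    exact hmono.pdX_u_neg_surface hg hL (hγ 0 (left_mem_Icc.2 W.m_pos.le)) hγ' hux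
      (fun p hp => (hΩ p hp).le) h₀ h₁
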